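/- Let p ≥ 8 be an integer divisible by 4, and let R be the set of distinct complex roots of Q_p that are different from √-1 and -√-1. Then Q_p'(a) ≠ 0 for every a ∈ R, and ∑_{a ∈ R} 2(1-a²)³(1+a²)·a^(p-5) / Q_p'(a) = 64 / (p² - 20). -/

import Mathlib

open Polynomial

/-- The polynomial `Q_p(X) = 1 - X^(p-4) + X^(p-2) + 2X^p + X^(p+2) - X^(p+4) + X^(2p)` in `ℤ[X]`
(for `p ≥ 5`). -/
noncomputable def Qp (p : ℕ) : Polynomial ℤ :=
  1 - X ^ (p - 4) + X ^ (p - 2) + 2 * X ^ p + X ^ (p + 2) - X ^ (p + 4) + X ^ (2 * p)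

/-- The set of distinct complex roots of `Q_p`. -/
noncomputable def QpRoots (p : ℕ) : Finset ℂ :=
  ((Qp p).map (Int.castRingHom ℂ)).roots.toFinset

/-- Lagrange interpolation: `∑ M(a) / H'(a) = 0` over the roots of a monic squarefree `H`
with `deg M ≤ deg H - 2`. -/
theorem sum_eval_div_eval_derivative_eq_zero {F : Type*} [Field F] [IsAlgClosed F] [DecidableEq F]
    {H M : F[X]} (hH : H.Monic) (hsimple : ∀ a, H.eval a = 0 → (derivative H).eval a ≠ 0)
    (hdeg : M.natDegree + 2 ≤ H.natDegree) :
    ∑ a ∈ H.roots.toFinset, M.eval a / (derivative H).eval a = 0 := by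
  have hnodup : H.roots.Nodup := by
    refine nodup_roots ((separable_def H).2 ?_)
    refine isCoprime_of_irreducible_dvd (fun h => hH.ne_zero h.1) fun z hz hzH hzd => ?_
    obtain ⟨a, ha⟩ := IsAlgClosed.exists_root z
      (degree_pos_of_irreducible hz).ne'
    exact hsimple a (ha.dvd hzH) (ha.dvd hzd)
  have hcard : H.roots.toFinset.card = H.natDegree := by
    rw [Multiset.toFinset_card_of_nodup hnodup, ← (IsAlgClosed.splits H).natDegree_eq_card_roots]
  have hnodal : Lagrange.nodal H.roots.toFinset id = H := by
    conv_rhs => rw [(IsAlgClosed.splits H).eq_prod_roots_of_monic hH]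
    rw [Lagrange.nodal_eq, Finset.prod_eq_multiset_prod, Multiset.toFinset_val,
      hnodup.dedup]
    rfl
  have hlt : M.degree < H.roots.toFinset.card := by
    rw [hcard]
    exact degree_le_natDegree.trans_lt (by exact_mod_cast (by omega : M.natDegree < H.natDegree))
  have key := Lagrange.coeff_eq_sum (v := id) (Set.injOn_id _) hlt
  rw [coeff_eq_zero_of_natDegree_lt (by omega)] at key
  rw [key]
  refine Finset.sum_congr rfl fun a ha => ?_
  have hder := Lagrange.eval_nodal_derivative_eval_node_eq (v := id) ha
  rw [hnodal, Lagrange.eval_nodal] at hder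
  exact congrArg _ hder

theorem aeval_Qp (j : ℕ) (a : ℂ) :
    aeval a (Qp (4 * j + 8)) = 1 - a ^ (4 * j + 4) + a ^ (4 * j + 6) + 2 * a ^ (4 * j + 8) +
      a ^ (4 * j + 10) - a ^ (4 * j + 12) + a ^ (8 * j + 16) := by
  rw [Qp, show 4 * j + 8 - 4 = 4 * j + 4 by omega, show 4 * j + 8 - 2 = 4 * j + 6 by omega,
    show 2 * (4 * j + 8) = 8 * j + 16 by ring]
  simp [map_ofNat (aeval a)]

theorem derivative_Qp (j : ℕ) :
    derivative (Qp (4 * j + 8)) = - (4 * (j : ℤ[X]) + 4) * X ^ (4 * j + 3)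
      + (4 * (j : ℤ[X]) + 6) * X ^ (4 * j + 5)
      + 2 * (4 * (j : ℤ[X]) + 8) * X ^ (4 * j + 7) + (4 * (j : ℤ[X]) + 10) * X ^ (4 * j + 9)
      - (4 * (j : ℤ[X]) + 12) * X ^ (4 * j + 11) + (8 * (j : ℤ[X]) + 16) * X ^ (8 * j + 15) := by
  rw [Qp, show 4 * j + 8 - 4 = 4 * j + 4 by omega, show 4 * j + 8 - 2 = 4 * j + 6 by omega,
    show 2 * (4 * j + 8) = 8 * j + 16 by ring]
  simp
  ring

theorem aeval_derivative_Qp (j : ℕ) (a : ℂ) :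
    aeval a (derivative (Qp (4 * j + 8))) = - (4 * (j : ℂ) + 4) * a ^ (4 * j + 3)
      + (4 * (j : ℂ) + 6) * a ^ (4 * j + 5)
      + 2 * (4 * (j : ℂ) + 8) * a ^ (4 * j + 7) + (4 * (j : ℂ) + 10) * a ^ (4 * j + 9)
      - (4 * (j : ℂ) + 12) * a ^ (4 * j + 11) + (8 * (j : ℂ) + 16) * a ^ (8 * j + 15) := by
  simp [derivative_Qp, map_ofNat (aeval a)]

theorem pow_four_mul_add_of_sq_eq_neg_one {R : Type*} [CommRing R] {z : R}
    (hz : z ^ 2 = -1) (j r : ℕ) :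
    z ^ (4 * j + r) = z ^ r := by
  rw [pow_add, pow_mul, show z ^ 4 = (z ^ 2) ^ 2 by ring, hz]
  simp

theorem pow_eight_mul_add_of_sq_eq_neg_one {R : Type*} [CommRing R] {z : R}
    (hz : z ^ 2 = -1) (j r : ℕ) :
    z ^ (8 * j + r) = z ^ r := by
  rw [show 8 * j + r = 4 * (2 * j) + r by ring, pow_four_mul_add_of_sq_eq_neg_one hz]

theorem aeval_Qp_of_sq_eq_neg_one (j : ℕ) {z : ℂ} (hz : z ^ 2 = -1) :
    aeval z (Qp (4 * j + 8)) = 0 := by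
  simp only [aeval_Qp, pow_four_mul_add_of_sq_eq_neg_one hz, pow_eight_mul_add_of_sq_eq_neg_one hz]
  grind

theorem aeval_derivative_Qp_of_sq_eq_neg_one (j : ℕ) {z : ℂ} (hz : z ^ 2 = -1) :
    aeval z (derivative (Qp (4 * j + 8))) = 0 := by
  simp only [aeval_derivative_Qp, pow_four_mul_add_of_sq_eq_neg_one hz,
    pow_eight_mul_add_of_sq_eq_neg_one hz]
  grind

theorem aeval_derivative_derivative_Qp_of_sq_eq_neg_one (j : ℕ) {z : ℂ} (hz : z ^ 2 = -1) :
    aeval z (derivative (derivative (Qp (4 * j + 8)))) = 2 * (20 - (4 * (j : ℂ) + 8) ^ 2) := by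
  simp [derivative_Qp, map_ofNat (aeval z), pow_four_mul_add_of_sq_eq_neg_one hz,
    pow_eight_mul_add_of_sq_eq_neg_one hz]
  grind

theorem monic_Qp (j : ℕ) : (Qp (4 * j + 8)).Monic ∧ (Qp (4 * j + 8)).natDegree = 8 * j + 16 := by
  rw [Qp, show 4 * j + 8 - 4 = 4 * j + 4 by omega, show 4 * j + 8 - 2 = 4 * j + 6 by omega,
    show 2 * (4 * j + 8) = 8 * j + 16 by ring]
  have h : (1 - X ^ (4 * j + 4) + X ^ (4 * j + 6) + 2 * X ^ (4 * j + 8) + X ^ (4 * j + 8 + 2)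
      - X ^ (4 * j + 8 + 4) : ℤ[X]).natDegree < 8 * j + 16 := by
    refine lt_of_le_of_lt (b := 4 * j + 12) ?_ (by omega)
    compute_degree
  have h' := degree_le_natDegree.trans_lt (Nat.cast_lt.2 h)
  rw [add_comm]
  exact ⟨monic_X_pow_add h', by
    rw [natDegree_add_eq_left_of_natDegree_lt (by simpa using h), natDegree_X_pow]⟩

/-- The common relation forced on `t = a² + a⁻²` at a multiple root is incompatible with `t` being
an algebraic integer. -/
theorem not_isIntegral_of_quadratic_relation {k : ℤ} {t : ℂ} (ht : IsIntegral ℤ t)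
    (h : 4 * (2 * t - 1) ^ 2 = (4 * (k : ℂ)) ^ 2 * (t - 3) * (t + 1)) : False := by
  have hint : IsIntegral ℤ ((k ^ 2 - 1 : ℤ) * t ^ 2 - (2 * k ^ 2 - 1 : ℤ) * t : ℂ) :=
    ((isIntegral_algebraMap (R := ℤ) (A := ℂ) (x := k ^ 2 - 1)).mul (ht.pow 2)).sub
      ((isIntegral_algebraMap (R := ℤ) (A := ℂ) (x := 2 * k ^ 2 - 1)).mul ht)
  have heq : ((k ^ 2 - 1 : ℤ) * t ^ 2 - (2 * k ^ 2 - 1 : ℤ) * t : ℂ) =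
      algebraMap ℚ ℂ ((12 * k ^ 2 + 1) / 4) := by
    push_cast [eq_ratCast]
    linear_combination (-1 / 16 : ℂ) * h
  rw [heq, isIntegral_algebraMap_iff (algebraMap ℚ ℂ).injective] at hint
  obtain ⟨n, hn⟩ := IsIntegrallyClosed.algebraMap_eq_of_integral hint
  have hn' : (4 * n : ℚ) = 12 * k ^ 2 + 1 := by
    simp only [eq_intCast] at hn
    rw [hn]; ring
  norm_cast at hn'
  omega

theorem aeval_derivative_Qp_ne_zero (j : ℕ) {a : ℂ} (hroot : aeval a (Qp (4 * j + 8)) = 0)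
    (ha : a ^ 2 ≠ -1) : aeval a (derivative (Qp (4 * j + 8))) ≠ 0 := by
  intro hder
  have hint : IsIntegral ℤ a := ⟨_, (monic_Qp j).1, hroot⟩
  have ha0 : a ≠ 0 := by
    rintro rfl
    simp [aeval_Qp] at hroot
  have hinv : IsIntegral ℤ a⁻¹ := by
    refine ⟨_, (monic_Qp j).1, ?_⟩
    change aeval a⁻¹ (Qp (4 * j + 8)) = 0
    have : aeval a⁻¹ (Qp (4 * j + 8)) = (a⁻¹) ^ (8 * j + 16) * aeval a (Qp (4 * j + 8)) := by
      simp only [aeval_Qp, inv_pow]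
      field_simp
      ring
    rw [this, hroot, mul_zero]
  have hsq : a ^ 2 ≠ 1 := by
    intro h
    have hpow : ∀ n, a ^ (2 * n) = 1 := fun n => by rw [pow_mul, h, one_pow]
    rw [aeval_Qp, show 4 * j + 4 = 2 * (2 * j + 2) by ring,
      show 4 * j + 6 = 2 * (2 * j + 3) by ring, show 4 * j + 8 = 2 * (2 * j + 4) by ring,
      show 4 * j + 10 = 2 * (2 * j + 5) by ring, show 4 * j + 12 = 2 * (2 * j + 6) by ring,
      show 8 * j + 16 = 2 * (4 * j + 8) by ring] at hroot
    simp only [hpow] at hroot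
    norm_num at hroot
  have hroot' : 1 - a ^ (4 * j + 4) * (1 - a ^ 2 - 2 * a ^ 4 - a ^ 6 + a ^ 8)
      + (a ^ (4 * j + 4)) ^ 2 * a ^ 8 = 0 := by
    rw [← hroot, aeval_Qp]; ring
  have hder' : -(4 * (j : ℂ) + 4) + (4 * (j : ℂ) + 6) * a ^ 2 + 2 * (4 * (j : ℂ) + 8) * a ^ 4
      + (4 * (j : ℂ) + 10) * a ^ 6 - (4 * (j : ℂ) + 12) * a ^ 8
      + (8 * (j : ℂ) + 16) * a ^ (4 * j + 4) * a ^ 8 = 0 := by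
    refine (mul_eq_zero.1 (?_ : a ^ (4 * j + 3) * _ = 0)).resolve_left (pow_ne_zero _ ha0)
    rw [← hder, aeval_derivative_Qp]; ring
  generalize a ^ (4 * j + 4) = v at hroot' hder'
  have hprod : ((1 - a ^ 2) * (1 + a ^ 2)) ^ 2 * (4 * (2 - a ^ 2 + 2 * a ^ 4) ^ 2
      - (4 * (j : ℂ) + 8) ^ 2 * (a ^ 4 - 3 * a ^ 2 + 1) * (a ^ 4 + a ^ 2 + 1)) = 0 := by
    let P : ℂ := 4 * (j : ℂ) + 8
    let B : ℂ := 1 - a ^ 2 - 2 * a ^ 4 - a ^ 6 + a ^ 8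
    let E : ℂ := -(4 * (j : ℂ) + 4) + (4 * (j : ℂ) + 6) * a ^ 2 + 2 * P * a ^ 4
      + (4 * (j : ℂ) + 10) * a ^ 6 - (4 * (j : ℂ) + 12) * a ^ 8
    linear_combination (4 * P ^ 2 * a ^ 8) * hroot'
      + (E + 2 * P * B - 2 * P * v * a ^ 8) * hder'
  have hfac := (mul_eq_zero.1 hprod).resolve_left <| pow_ne_zero _ <| mul_ne_zero
    (sub_ne_zero.2 hsq.symm) fun h => ha (by linear_combination h)
  refine not_isIntegral_of_quadratic_relation (k := j + 2) (t := a ^ 2 + (a⁻¹) ^ 2)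
    ((hint.pow 2).add (hinv.pow 2)) ?_
  push_cast
  field_simp
  linear_combination hfac / 4

theorem exists_monic_factor_map_Qp (j : ℕ) : ∃ H : ℂ[X], H.Monic ∧ H.natDegree = 8 * j + 14 ∧
    (Qp (4 * j + 8)).map (Int.castRingHom ℂ) = (X ^ 2 + 1) * H := by
  have hfac : (X ^ 2 + 1 : ℂ[X]) = (X - C Complex.I) * (X - C (-Complex.I)) := by
    have : (C Complex.I : ℂ[X]) ^ 2 = -1 := by rw [← C_pow, Complex.I_sq]; simp
    simp only [C_neg]
    linear_combination this
  have hdvd : (X ^ 2 + 1 : ℂ[X]) ∣ (Qp (4 * j + 8)).map (Int.castRingHom ℂ) := by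
    rw [hfac]
    refine IsCoprime.mul_dvd (isCoprime_X_sub_C_of_isUnit_sub ?_) ?_ ?_
    · simp [← two_mul]
    all_goals
      rw [dvd_iff_isRoot, IsRoot, eval_map, ← algebraMap_int_eq, ← aeval_def]
      exact aeval_Qp_of_sq_eq_neg_one j (by simp)
  obtain ⟨H, hH⟩ := hdvd
  have hX : (X ^ 2 + 1 : ℂ[X]).Monic := by rw [hfac]; exact (monic_X_sub_C _).mul (monic_X_sub_C _)
  have hHm : H.Monic := hX.of_mul_monic_left (hH ▸ (monic_Qp j).1.map _)
  refine ⟨H, hHm, ?_, hH⟩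
  have hdeg := congrArg natDegree hH
  rw [(monic_Qp j).1.natDegree_map, (monic_Qp j).2, hX.natDegree_mul hHm, hfac,
    (monic_X_sub_C _).natDegree_mul (monic_X_sub_C _), natDegree_X_sub_C, natDegree_X_sub_C] at hdeg
  omega

theorem four_mul_add_eight_sq_sub_twenty_ne_zero (j : ℕ) : (4 * (j : ℂ) + 8) ^ 2 - 20 ≠ 0 := by
  have : (4 * (j : ℤ) + 8) ^ 2 - 20 ≠ 0 := by
    have : 0 < 16 * (j : ℤ) ^ 2 + 64 * j + 44 := by positivity
    intro h
    linarith
  exact_mod_cast this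

/-- for `p ≥ 8` divisible by `4`, with `R` the set of distinct complex roots of
`Q_p` different from `±√-1`, one has `Q_p'(a) ≠ 0` for all `a ∈ R` and
`∑_{a ∈ R} 2(1-a²)³(1+a²)a^(p-5) / Q_p'(a) = 64/(p²-20)`. -/
theorem stmt13 (p : ℕ) (hp : 8 ≤ p) (hp4 : 4 ∣ p) :
    (∀ a ∈ QpRoots p \ {Complex.I, -Complex.I},
        Polynomial.aeval a (derivative (Qp p)) ≠ 0) ∧
    ∑ a ∈ QpRoots p \ {Complex.I, -Complex.I},
        2 * (1 - a ^ 2) ^ 3 * (1 + a ^ 2) * a ^ (p - 5) /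
          Polynomial.aeval a (derivative (Qp p)) = 64 / ((p : ℂ) ^ 2 - 20) := by
  obtain ⟨j, rfl⟩ : ∃ j, p = 4 * j + 8 := by
    obtain ⟨k, rfl⟩ := hp4
    exact ⟨k - 2, by omega⟩
  obtain ⟨H, hHm, hHdeg, hH⟩ := exists_monic_factor_map_Qp j
  have heval (P : ℤ[X]) (a : ℂ) : aeval a P = (P.map (Int.castRingHom ℂ)).eval a := by
    rw [eval_map, ← algebraMap_int_eq, aeval_def]
  have hsq (a : ℂ) : a ^ 2 = -1 ↔ a = Complex.I ∨ a = -Complex.I := by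
    rw [← Complex.I_sq, sq_eq_sq_iff_eq_or_eq_neg]
  have hQ (a : ℂ) : aeval a (Qp (4 * j + 8)) = (a ^ 2 + 1) * H.eval a := by simp [heval, hH]
  have hQ' (a : ℂ) : aeval a (derivative (Qp (4 * j + 8))) =
      2 * a * H.eval a + (a ^ 2 + 1) * (derivative H).eval a := by
    simp [heval, ← derivative_map, hH, one_add_one_eq_two]
  have hQ'' (a : ℂ) : aeval a (derivative (derivative (Qp (4 * j + 8)))) =
      2 * H.eval a + 4 * a * (derivative H).eval a
        + (a ^ 2 + 1) * (derivative (derivative H)).eval a := by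
    simp [heval, ← derivative_map, hH, one_add_one_eq_two]
    ring
  have hHi {z : ℂ} (hz : z ^ 2 = -1) :
      H.eval z = 0 ∧ 2 * z * (derivative H).eval z = 20 - (4 * (j : ℂ) + 8) ^ 2 := by
    have hz0 : z ≠ 0 := by rintro rfl; simp at hz
    have h1 := hQ' z
    have h2 := hQ'' z
    rw [aeval_derivative_Qp_of_sq_eq_neg_one j hz, hz] at h1
    rw [aeval_derivative_derivative_Qp_of_sq_eq_neg_one j hz, hz] at h2
    have h0 : H.eval z = 0 := by simpa [hz0] using h1.symm
    rw [h0] at h2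
    exact ⟨h0, by linear_combination -h2 / 2⟩
  have hp20 := four_mul_add_eight_sq_sub_twenty_ne_zero j
  have hmem (a : ℂ) : a ∈ QpRoots (4 * j + 8) \ {Complex.I, -Complex.I} ↔
      aeval a (Qp (4 * j + 8)) = 0 ∧ a ^ 2 ≠ -1 := by
    have := ((monic_Qp j).1.map (Int.castRingHom ℂ)).ne_zero
    rw [Finset.mem_sdiff, QpRoots, Multiset.mem_toFinset, mem_roots this, IsRoot, ← heval]
    simp [hsq]
  have hsimple (a : ℂ) (ha : H.eval a = 0) : (derivative H).eval a ≠ 0 := by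
    intro hd
    by_cases hz : a ^ 2 = -1
    · have := (hHi hz).2
      rw [hd] at this
      exact hp20 (by linear_combination this)
    · exact aeval_derivative_Qp_ne_zero j (by simp [hQ, ha]) hz (by simp [hQ', ha, hd])
  refine ⟨fun a ha => aeval_derivative_Qp_ne_zero j ((hmem a).1 ha).1 ((hmem a).1 ha).2, ?_⟩
  have hroots : H.roots.toFinset =
      (QpRoots (4 * j + 8) \ {Complex.I, -Complex.I}) ∪ {Complex.I, -Complex.I} := by
    ext a
    rw [Finset.mem_union, hmem, Multiset.mem_toFinset, mem_roots hHm.ne_zero, IsRoot, hQ,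
      Finset.mem_insert, Finset.mem_singleton, ← hsq, mul_eq_zero, add_eq_zero_iff_eq_neg]
    have := fun h => (hHi (z := a) h).1
    tauto
  have hsum := sum_eval_div_eval_derivative_eq_zero
    (M := 2 * (1 - X ^ 2) ^ 3 * X ^ (4 * j + 3)) hHm hsimple (by
      rw [hHdeg]
      have : (2 * (1 - X ^ 2) ^ 3 * X ^ (4 * j + 3) : ℂ[X]).natDegree ≤ 4 * j + 9 := by
        compute_degree
        omega
      omega)
  have hI : Complex.I ≠ -Complex.I := by
    simp [eq_neg_iff_add_eq_zero, ← two_mul]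
  have hterm {z : ℂ} (hz : z ^ 2 = -1) :
      (2 * (1 - X ^ 2) ^ 3 * X ^ (4 * j + 3) : ℂ[X]).eval z / (derivative H).eval z =
        -32 / ((4 * (j : ℂ) + 8) ^ 2 - 20) := by
    obtain ⟨h0, h1⟩ := hHi hz
    rw [div_eq_div_iff (hsimple z h0) hp20]
    simp only [eval_mul, eval_pow, eval_sub, eval_one, eval_X, eval_ofNat,
      pow_four_mul_add_of_sq_eq_neg_one hz]
    grind
  rw [hroots, Finset.sum_union Finset.sdiff_disjoint, Finset.sum_pair hI,
    hterm Complex.I_sq, hterm (by simp)] at hsum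
  have hcongr : ∑ a ∈ QpRoots (4 * j + 8) \ {Complex.I, -Complex.I},
        2 * (1 - a ^ 2) ^ 3 * (1 + a ^ 2) * a ^ (4 * j + 8 - 5) /
          aeval a (derivative (Qp (4 * j + 8))) =
      ∑ a ∈ QpRoots (4 * j + 8) \ {Complex.I, -Complex.I},
        (2 * (1 - X ^ 2) ^ 3 * X ^ (4 * j + 3) : ℂ[X]).eval a / (derivative H).eval a := by
    refine Finset.sum_congr rfl fun a ha => ?_
    obtain ⟨h0, h1⟩ := (hmem a).1 ha
    have h2 : a ^ 2 + 1 ≠ 0 := fun h => h1 (by linear_combination h)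
    have h3 : H.eval a = 0 := by simpa [hQ, h2] using h0
    have h4 := hsimple a h3
    rw [hQ', h3, show 4 * j + 8 - 5 = 4 * j + 3 by omega]
    simp only [eval_mul, eval_pow, eval_sub, eval_one, eval_X, eval_ofNat, mul_zero, zero_add]
    field_simp
    ring
  rw [hcongr]
  push_cast
  linear_combination hsum
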